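/- Let w ∈ CNV_-. Then for every c ≥ 1 and every ε > 0 there exists a constant C ≥ 0 such that c^{−1} w(ct) + ε·∑_{j=1}^n t_j ≤ w(t) + C for all t ∈ ℝ^n_-. In particular, the function t ↦ c^{−1} w(ct) + ε·∑_j t_j belongs to the class of functions v ∈ CNV_- satisfying v ≤ w + O(1) on ℝ^n_-. -/

import Mathlib

open MeasureTheory Set Filter

/-- The open negative orthant in `ℝ^n`. -/
def negOrth (n : ℕ) : Set (Fin n → ℝ) := {t | ∀ j, t j < 0}

/-- The class `CNV₋`: convex, negative functions on the negative orthant that are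
nondecreasing in each variable. -/
def CNVm (n : ℕ) (w : (Fin n → ℝ) → ℝ) : Prop :=
  ConvexOn ℝ (negOrth n) w ∧ (∀ t ∈ negOrth n, w t < 0) ∧
    ∀ t ∈ negOrth n, ∀ s ∈ negOrth n, (∀ j, t j ≤ s j) → w t ≤ w s

/-- A convex function on an open convex subset of a finite-dimensional space has a subgradient at
every point. -/
theorem ConvexOn.exists_subgradient {E : Type*} [NormedAddCommGroup E] [NormedSpace ℝ E]
    [FiniteDimensional ℝ E] {s : Set E} {φ : E → ℝ} (hs : IsOpen s) (hφ : ConvexOn ℝ s φ)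
    {x : E} (hx : x ∈ s) :
    ∃ l : E →L[ℝ] ℝ, ∀ y ∈ s, φ x + l (y - x) ≤ φ y := by
  have hopen : IsOpen {p : E × ℝ | p.1 ∈ s ∧ φ p.1 < p.2} := by
    have hcont : ContinuousOn (fun p : E × ℝ => p.2 - φ p.1) (Prod.fst ⁻¹' s) :=
      continuousOn_snd.sub
        ((hφ.continuousOn hs).comp continuousOn_fst fun _ hp => hp)
    convert hcont.isOpen_inter_preimage (hs.preimage continuous_fst) (isOpen_Ioi (a := (0 : ℝ))) using 1
    ext p
    simp
  obtain ⟨f, hf⟩ := geometric_hahn_banach_point_open (x := (x, φ x)) hφ.convex_strict_epigraph hopen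
    (by simp)
  have hsplit (y : E) (r : ℝ) : f (y, r) = f (y, 0) + r * f (0, 1) := by
    rw [← smul_eq_mul, ← map_smul, ← map_add]
    simp
  have hβ : 0 < f (0, 1) := by
    have h := hf (x, φ x + 1) ⟨hx, by simp⟩
    rw [hsplit x, hsplit x (φ x + 1)] at h
    linarith
  refine ⟨-(f (0, 1))⁻¹ • f.comp (ContinuousLinearMap.inl ℝ E ℝ), fun y hy => ?_⟩
  refine le_of_forall_gt_imp_ge_of_dense fun r hr => ?_
  have h := hf (y, r) ⟨hy, hr⟩
  rw [hsplit x, hsplit y] at h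
  have hdiv : (f (0, 1))⁻¹ * (f (x, 0) - f (y, 0)) ≤ r - φ x := by
    rw [inv_mul_le_iff₀ hβ]
    linarith
  simp only [smul_apply, map_sub, ContinuousLinearMap.comp_apply,
    ContinuousLinearMap.inl_apply, smul_eq_mul]
  linarith

/-- Up to an additive error `ε`, a set of nonnegative vectors is dominated from below by finitely
many of its elements. -/
theorem exists_finite_subset_forall_le_add {ι : Type*} [Finite ι] {A : Set (ι → ℝ)}
    (hA : ∀ a ∈ A, ∀ j, 0 ≤ a j) {ε : ℝ} (hε : 0 < ε) :
    ∃ F ⊆ A, F.Finite ∧ ∀ a ∈ A, ∃ b ∈ F, ∀ j, b j ≤ a j + ε := by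
  let q : (ι → ℝ) → ι → ℕ := fun a j => ⌊a j / ε⌋₊
  have hfin : {m | Minimal (· ∈ q '' A) m}.Finite :=
    WellQuasiOrderedLE.finite_of_isAntichain (setOfPred_minimal_antichain _)
  obtain ⟨F, hFA, hF, hqF⟩ := (exists_subset_image_finite_and (f := q) (s := A)
    (p := fun M => ∀ a ∈ A, ∃ m ∈ M, m ≤ q a)).1
    ⟨_, fun m hm => hm.prop, hfin, fun a ha => by
      obtain ⟨m, hma, hm⟩ := exists_minimal_le_of_wellFoundedLT (· ∈ q '' A) (q a) ⟨a, ha, rfl⟩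
      exact ⟨m, hm, hma⟩⟩
  refine ⟨F, hFA, hF, fun a ha => ?_⟩
  obtain ⟨_, ⟨b, hb, rfl⟩, hba⟩ := hqF a ha
  refine ⟨b, hb, fun j => ?_⟩
  have h₁ : b j / ε < ⌊b j / ε⌋₊ + 1 := Nat.lt_floor_add_one _
  have h₂ : (⌊a j / ε⌋₊ : ℝ) ≤ a j / ε := Nat.floor_le (div_nonneg (hA a ha j) hε.le)
  have h₃ : (⌊b j / ε⌋₊ : ℝ) ≤ ⌊a j / ε⌋₊ := Nat.cast_le.2 (hba j)
  have h₄ : b j / ε ≤ a j / ε + 1 := by linarith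
  rwa [div_le_iff₀ hε, add_mul, one_mul, div_mul_cancel₀ _ hε.ne'] at h₄

theorem isOpen_negOrth (n : ℕ) : IsOpen (negOrth n) := by
  simp only [negOrth, ofPred_forall]
  exact isOpen_iInter_of_finite fun j => isOpen_lt (continuous_apply j) continuous_const

theorem smul_mem_negOrth {n : ℕ} {c : ℝ} (hc : 0 < c) {t : Fin n → ℝ} (ht : t ∈ negOrth n) :
    c • t ∈ negOrth n :=
  fun j => mul_neg_of_pos_of_neg hc (ht j)

/-- A function in `CNV₋` has a subgradient with nonnegative coordinates at every point `x`, and the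
corresponding linear form is at least `w x` at `x`. -/
theorem CNVm.exists_subgradient {n : ℕ} {w : (Fin n → ℝ) → ℝ} (hw : CNVm n w)
    {x : Fin n → ℝ} (hx : x ∈ negOrth n) :
    ∃ a : Fin n → ℝ, (∀ j, 0 ≤ a j) ∧ w x ≤ ∑ j, a j * x j ∧
      ∀ t ∈ negOrth n, w x + (∑ j, a j * t j - ∑ j, a j * x j) ≤ w t := by
  obtain ⟨hconv, hneg, hmono⟩ := hw
  obtain ⟨l, hl⟩ := hconv.exists_subgradient (isOpen_negOrth n) hx
  have hsum (t : Fin n → ℝ) : l t = ∑ j, l (Pi.single j 1) * t j := by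
    conv_lhs => rw [pi_eq_sum_univ' t, map_sum]
    refine Finset.sum_congr rfl fun j _ => ?_
    rw [map_smul, smul_eq_mul, mul_comm]
  refine ⟨fun j => l (Pi.single j 1), fun j => ?_, ?_, fun t ht => ?_⟩
  · have hle (i : Fin n) : (x - Pi.single j (1 : ℝ) : Fin n → ℝ) i ≤ x i := by
      have : (0 : Fin n → ℝ) ≤ Pi.single j 1 := Pi.single_nonneg.2 zero_le_one
      simpa using this i
    have hmem : x - Pi.single j (1 : ℝ) ∈ negOrth n := fun i => (hle i).trans_lt (hx i)
    have h₁ := hl _ hmem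
    have h₂ := hmono _ hmem x hx hle
    rw [sub_sub_cancel_left, map_neg] at h₁
    linarith
  · rw [← hsum]
    by_contra! hlt
    have hbound (δ : ℝ) (hδ : 0 < δ) : w x - l x < -δ * l x := by
      have h₁ := hl _ (smul_mem_negOrth hδ hx)
      have h₂ := hneg _ (smul_mem_negOrth hδ hx)
      rw [map_sub, map_smul, smul_eq_mul] at h₁
      linarith
    have hlx : l x < 0 := hlt.trans (hneg x hx)
    have h := hbound ((w x - l x) / (-l x)) (div_pos (by linarith) (by linarith))
    rw [neg_mul, ← mul_neg, div_mul_cancel₀ _ (by linarith)] at h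
    exact h.false
  · have h := hl t ht
    rwa [map_sub, hsum t, hsum x] at h

/-- For `w ∈ CNV₋`, every `c ≥ 1` and `ε > 0`, there is `C ≥ 0` with
`c⁻¹ w(ct) + ε ∑ⱼ tⱼ ≤ w(t) + C` on the negative orthant; in particular the function
`t ↦ c⁻¹ w(ct) + ε ∑ⱼ tⱼ` belongs to `CNV₋` and satisfies `v ≤ w + O(1)`. -/
theorem scaled_plus_linear_in_class {n : ℕ} (hn : 1 ≤ n)
    (w : (Fin n → ℝ) → ℝ) (hw : CNVm n w) :
    ∀ c : ℝ, 1 ≤ c → ∀ ε : ℝ, 0 < ε →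
      (∃ C : ℝ, 0 ≤ C ∧ ∀ t ∈ negOrth n,
        c⁻¹ * w (c • t) + ε * (∑ j, t j) ≤ w t + C) ∧
      CNVm n (fun t => c⁻¹ * w (c • t) + ε * (∑ j, t j)) := by
  intro c hc ε hε
  have hc₀ : 0 < c := zero_lt_one.trans_le hc
  constructor
  · let A : Set (Fin n → ℝ) :=
      {a | (∀ j, 0 ≤ a j) ∧ ∃ C : ℝ, ∀ t ∈ negOrth n, ∑ j, a j * t j ≤ w t + C}
    obtain ⟨F, hFA, hF, hAF⟩ := exists_finite_subset_forall_le_add (A := A) (fun a ha => ha.1) hε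
    choose! K hK using fun a (ha : a ∈ A) => ha.2
    obtain ⟨B, hB⟩ := (hF.image K).bddAbove
    refine ⟨max 0 B, le_max_left _ _, fun t ht => ?_⟩
    obtain ⟨a, ha, hax, hsub⟩ := hw.exists_subgradient (smul_mem_negOrth hc₀ ht)
    have haA : a ∈ A := by
      refine ⟨ha, ∑ j, a j * (c • t) j - w (c • t), fun s hs => ?_⟩
      have := hsub s hs
      linarith
    obtain ⟨b, hb, hba⟩ := hAF a haA
    calc c⁻¹ * w (c • t) + ε * ∑ j, t j
        ≤ ∑ j, a j * t j + ε * ∑ j, t j := by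
          gcongr
          rw [inv_mul_le_iff₀ hc₀, Finset.mul_sum]
          refine hax.trans_eq (Finset.sum_congr rfl fun j _ => ?_)
          simp only [Pi.smul_apply, smul_eq_mul]
          ring
      _ = ∑ j, (a j + ε) * t j := by
          rw [Finset.mul_sum, ← Finset.sum_add_distrib]
          exact Finset.sum_congr rfl fun j _ => (add_mul _ _ _).symm
      _ ≤ ∑ j, b j * t j :=
          Finset.sum_le_sum fun j _ => mul_le_mul_of_nonpos_right (hba j) (ht j).le
      _ ≤ w t + K b := hK b (hFA hb) t ht
      _ ≤ w t + max 0 B := by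
          gcongr
          exact (hB (mem_image_of_mem K hb)).trans (le_max_right _ _)
  · obtain ⟨hconv, hneg, hmono⟩ := hw
    refine ⟨⟨hconv.1, fun x hx y hy a b ha hb hab => ?_⟩, fun t ht => ?_, fun t ht s hs hts => ?_⟩
    · have h := hconv.2 (smul_mem_negOrth hc₀ hx) (smul_mem_negOrth hc₀ hy) ha hb hab
      have h' := mul_le_mul_of_nonneg_left h (inv_nonneg.2 hc₀.le)
      rw [smul_comm a c, smul_comm b c, ← smul_add] at h'
      simp only [Pi.add_apply, Pi.smul_apply, smul_eq_mul, Finset.sum_add_distrib,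
        ← Finset.mul_sum] at h' ⊢
      linarith
    · exact add_neg_of_neg_of_nonpos
        (mul_neg_of_pos_of_neg (inv_pos.2 hc₀) (hneg _ (smul_mem_negOrth hc₀ ht)))
        (mul_nonpos_of_nonneg_of_nonpos hε.le (Finset.sum_nonpos fun j _ => (ht j).le))
    · have h := hmono _ (smul_mem_negOrth hc₀ ht) _ (smul_mem_negOrth hc₀ hs) fun j =>
        mul_le_mul_of_nonneg_left (hts j) hc₀.le
      dsimp only
      gcongr with j
      exact hts j
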